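/- Suppose (v, q, ζ, h) solves the linearized surfactant system: ∂_t v − Δv + ∇q = Φ¹ and div v = Φ² in Ω; on Σ = {x₃ = 0}: (q I − 𝔻v) e₃ − (ζ − σ₀ Δ_* ζ) e₃ + σ₀′ (∂₁h, ∂₂h, 0) = Φ³, ∂_t ζ − v₃(·,0) = Φ⁴, and ∂_t h + c₀ (∂₁v₁ + ∂₂v₂)(·,0) − γ Δ_* h = Φ⁵; and v(·,−b) = 0 on the bottom {x₃ = −b}. Then for every t: d/dt [ ∫_{Q_Ω} |v|²/2 + ∫_Q ( |ζ|²/2 + σ₀|∇_*ζ|²/2 + (−σ₀′/(2c₀)) |h|² ) ] + ∫_{Q_Ω} |𝔻v|²/2 + (−γσ₀′/c₀) ∫_Q |∇_*h|² = ∫_{Q_Ω} ( v·Φ¹ + qΦ² − v·∇Φ² ) + ∫_Q ( −v(·,0)·Φ³ + ζΦ⁴ − σ₀ Φ⁴ Δ_*ζ − (σ₀′/c₀) Φ⁵ h ). -/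

import Mathlib

open Real MeasureTheory

noncomputable section

/-- The horizontal plane ℝ² (the boundary Σ = {x₃ = 0}). -/
abbrev E2 := EuclideanSpace ℝ (Fin 2)

/-- Three-dimensional space. -/
abbrev E3 := EuclideanSpace ℝ (Fin 3)

/-- Horizontal partial derivative ∂ᵢ of a function on ℝ². -/
noncomputable def pd (i : Fin 2) (f : E2 → ℝ) : E2 → ℝ :=
  fun x => fderiv ℝ f x (EuclideanSpace.single i 1)

/-- Partial derivative ∂ᵢ of a function on ℝ³. -/
noncomputable def pd3 (i : Fin 3) (f : E3 → ℝ) : E3 → ℝ :=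
  fun x => fderiv ℝ f x (EuclideanSpace.single i 1)

/-- Embedding of the horizontal plane at height z: x ↦ (x₁, x₂, z). -/
noncomputable def emb (z : ℝ) (x : E2) : E3 :=
  (EuclideanSpace.equiv (Fin 3) ℝ).symm ![x 0, x 1, z]

/-- Horizontal periodicity with periods L₁, L₂ for functions on ℝ². -/
def PeriodicE2 (L₁ L₂ : ℝ) (f : E2 → ℝ) : Prop :=
  (∀ x : E2, f (x + L₁ • EuclideanSpace.single 0 1) = f x) ∧
  (∀ x : E2, f (x + L₂ • EuclideanSpace.single 1 1) = f x)

/-- Horizontal periodicity with periods L₁, L₂ for functions on ℝ³. -/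
def PeriodicE3 (L₁ L₂ : ℝ) (f : E3 → ℝ) : Prop :=
  (∀ x : E3, f (x + L₁ • EuclideanSpace.single 0 1) = f x) ∧
  (∀ x : E3, f (x + L₂ • EuclideanSpace.single 1 1) = f x)

/-- The horizontal periodicity cell Q = [0,L₁] × [0,L₂]. -/
def Q2 (L₁ L₂ : ℝ) : Set E2 := {x : E2 | x 0 ∈ Set.Icc 0 L₁ ∧ x 1 ∈ Set.Icc 0 L₂}

/-- The fundamental cell Q_Ω = [0,L₁] × [0,L₂] × [−b,0] of the slab Ω. -/
def Q3 (L₁ L₂ b : ℝ) : Set E3 :=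
  {x : E3 | x 0 ∈ Set.Icc 0 L₁ ∧ x 1 ∈ Set.Icc 0 L₂ ∧ x 2 ∈ Set.Icc (-b) 0}

/-- The horizontal Laplacian Δ_* on ℝ². -/
noncomputable def lap2 (f : E2 → ℝ) (x : E2) : ℝ :=
  pd 0 (pd 0 f) x + pd 1 (pd 1 f) x

end

/-- Divergence theorem for one component on a box. -/
theorem aux_box {n : ℕ} (a b : Fin (n + 1) → ℝ) (hle : a ≤ b) (g : (Fin (n + 1) → ℝ) → ℝ)
    (hg : ContDiff ℝ 1 g) (k : Fin (n + 1)) :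
    ∫ x in Set.Icc a b, fderiv ℝ g x (Pi.single k 1) =
      (∫ x in Set.Icc (a ∘ Fin.succAbove k) (b ∘ Fin.succAbove k), g (Fin.insertNth k (b k) x)) -
      ∫ x in Set.Icc (a ∘ Fin.succAbove k) (b ∘ Fin.succAbove k), g (Fin.insertNth k (a k) x) := by
  have hcont : Continuous fun x => fderiv ℝ g x (Pi.single k 1) :=
    (hg.continuous_fderiv (by norm_num)).clm_apply continuous_const
  have key : ∀ x : Fin (n + 1) → ℝ, (∑ i, ((ContinuousLinearMap.single ℝ (fun _ : Fin (n + 1) => ℝ) k).comp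
      (fderiv ℝ g x)) (Pi.single i 1) i) = fderiv ℝ g x (Pi.single k 1) := by
    intro x
    rw [Finset.sum_eq_single k]
    · simp
    · intro j _ hj
      simp [hj]
    · simp
  have := integral_divergence_of_hasFDerivAt_off_countable a b hle
    (fun x => Pi.single k (g x))
    (fun x => (ContinuousLinearMap.single ℝ (fun _ : Fin (n + 1) => ℝ) k).comp (fderiv ℝ g x))
    ∅ Set.countable_empty
    (by
      have h1 : Continuous fun x => (ContinuousLinearMap.single ℝ (fun _ : Fin (n + 1) => ℝ) k) (g x) :=
        (ContinuousLinearMap.continuous _).comp hg.continuous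
      exact h1.continuousOn)
    (by
      intro x _
      exact (ContinuousLinearMap.single ℝ (fun _ : Fin (n + 1) => ℝ) k).hasFDerivAt.comp x
        ((hg.differentiable (by norm_num)) x).hasFDerivAt)
    (by
      simp only [key]
      exact hcont.continuousOn.integrableOn_compact isCompact_Icc)
  simp only [key] at this
  rw [this, Finset.sum_eq_single k]
  · simp
  · intro j _ hj
    simp [hj]
  · simp

/-- Transfer of box integrals from Euclidean space to the product space. -/
theorem aux_transfer {n : ℕ} (f : EuclideanSpace ℝ (Fin n) → ℝ) (a b : Fin n → ℝ) :
    ∫ x in {x : EuclideanSpace ℝ (Fin n) | ∀ i, x i ∈ Set.Icc (a i) (b i)}, f x =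
      ∫ y in Set.Icc a b, f (WithLp.toLp 2 y) := by
  rw [← (PiLp.volume_preserving_toLp (Fin n)).setIntegral_preimage_emb
    (MeasurableEquiv.toLp 2 (Fin n → ℝ)).measurableEmbedding]
  congr 2
  ext y
  simp only [Set.mem_preimage, Set.mem_ofPred_eq, Set.mem_Icc, Pi.le_def, forall_and]

theorem aux_Q2_eq (L₁ L₂ : ℝ) :
    Q2 L₁ L₂ = {x : E2 | ∀ i, x i ∈ Set.Icc ((![0, 0] : Fin 2 → ℝ) i) ((![L₁, L₂] : Fin 2 → ℝ) i)} := by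
  ext x
  simp [Q2, Fin.forall_fin_two]

theorem aux_Q3_eq (L₁ L₂ b : ℝ) :
    Q3 L₁ L₂ b = {x : E3 | ∀ i, x i ∈ Set.Icc ((![0, 0, -b] : Fin 3 → ℝ) i)
      ((![L₁, L₂, 0] : Fin 3 → ℝ) i)} := by
  ext x
  simp [Q3, Fin.forall_fin_succ]

theorem aux_int_Q2 (L₁ L₂ : ℝ) (f : E2 → ℝ) :
    ∫ x in Q2 L₁ L₂, f x = ∫ y in Set.Icc (![0, 0] : Fin 2 → ℝ) ![L₁, L₂], f (WithLp.toLp 2 y) := by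
  rw [aux_Q2_eq, aux_transfer]

theorem aux_int_Q3 (L₁ L₂ b : ℝ) (f : E3 → ℝ) :
    ∫ x in Q3 L₁ L₂ b, f x =
      ∫ y in Set.Icc (![0, 0, -b] : Fin 3 → ℝ) ![L₁, L₂, 0], f (WithLp.toLp 2 y) := by
  rw [aux_Q3_eq, aux_transfer]

theorem aux_compact {n : ℕ} (a b : Fin n → ℝ) :
    IsCompact {x : EuclideanSpace ℝ (Fin n) | ∀ i, x i ∈ Set.Icc (a i) (b i)} := by
  have h := (isCompact_Icc (a := a) (b := b)).image (PiLp.continuous_toLp 2 (fun _ : Fin n => ℝ))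
  convert h using 1
  ext x
  constructor
  · intro hx
    exact ⟨WithLp.ofLp x, ⟨fun i => (hx i).1, fun i => (hx i).2⟩, rfl⟩
  · rintro ⟨y, hy, rfl⟩ i
    exact ⟨hy.1 i, hy.2 i⟩

theorem aux_compact_Q2 (L₁ L₂ : ℝ) : IsCompact (Q2 L₁ L₂) := by
  rw [aux_Q2_eq]; exact aux_compact _ _

theorem aux_compact_Q3 (L₁ L₂ b : ℝ) : IsCompact (Q3 L₁ L₂ b) := by
  rw [aux_Q3_eq]; exact aux_compact _ _

theorem aux_fderiv_toLp {n : ℕ} (f : EuclideanSpace ℝ (Fin n) → ℝ) (hf : ContDiff ℝ 1 f)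
    (y : Fin n → ℝ) (i : Fin n) :
    fderiv ℝ (fun z : Fin n → ℝ => f (WithLp.toLp 2 z)) y (Pi.single i 1) =
      fderiv ℝ f (WithLp.toLp 2 y) (EuclideanSpace.single i 1) := by
  have h1 : HasFDerivAt (fun z : Fin n → ℝ => (WithLp.toLp 2 z : EuclideanSpace ℝ (Fin n)))
      ((EuclideanSpace.equiv (Fin n) ℝ).symm : (Fin n → ℝ) →L[ℝ] EuclideanSpace ℝ (Fin n)) y :=
    ((EuclideanSpace.equiv (Fin n) ℝ).symm : (Fin n → ℝ) →L[ℝ] EuclideanSpace ℝ (Fin n)).hasFDerivAt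
  have h2 := ((hf.differentiable (by norm_num)) (WithLp.toLp 2 y)).hasFDerivAt.comp y h1
  have h3 := h2.fderiv
  rw [show (fun z : Fin n → ℝ => f (WithLp.toLp 2 z)) =
    f ∘ (fun z : Fin n → ℝ => (WithLp.toLp 2 z : EuclideanSpace ℝ (Fin n))) from rfl, h3]
  rfl

theorem aux_contDiff_toLp {n : ℕ} (f : EuclideanSpace ℝ (Fin n) → ℝ) (hf : ContDiff ℝ 1 f) :
    ContDiff ℝ 1 (fun z : Fin n → ℝ => f (WithLp.toLp 2 z)) :=
  hf.comp ((EuclideanSpace.equiv (Fin n) ℝ).symm :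
    (Fin n → ℝ) →L[ℝ] EuclideanSpace ℝ (Fin n)).contDiff

theorem aux_div2 (L₁ L₂ : ℝ) (hL₁ : 0 < L₁) (hL₂ : 0 < L₂) (f : E2 → ℝ) (hf : ContDiff ℝ 1 f)
    (hp : PeriodicE2 L₁ L₂ f) (i : Fin 2) : ∫ x in Q2 L₁ L₂, pd i f x = 0 := by
  rw [aux_int_Q2]
  simp only [pd, ← aux_fderiv_toLp f hf]
  rw [aux_box _ _ _ _ (aux_contDiff_toLp f hf), sub_eq_zero]
  · congr 1
    funext x
    fin_cases i
    · refine Eq.trans ?_ (hp.1 _)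
      congr 1
      ext j
      fin_cases j <;> simp [Fin.insertNth, Fin.succAboveCases, EuclideanSpace.single]
    · refine Eq.trans ?_ (hp.2 _)
      congr 1
      ext j
      fin_cases j <;> simp [Fin.insertNth, Fin.succAboveCases, EuclideanSpace.single]
  · intro j
    fin_cases j <;> simp [hL₁.le, hL₂.le]

theorem aux_div3_hor (L₁ L₂ b : ℝ) (hL₁ : 0 < L₁) (hL₂ : 0 < L₂) (hb : 0 < b)
    (f : E3 → ℝ) (hf : ContDiff ℝ 1 f)
    (hp : PeriodicE3 L₁ L₂ f) (i : Fin 3) (hi : i ≠ 2) : ∫ x in Q3 L₁ L₂ b, pd3 i f x = 0 := by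
  rw [aux_int_Q3]
  simp only [pd3, ← aux_fderiv_toLp f hf]
  rw [aux_box _ _ _ _ (aux_contDiff_toLp f hf), sub_eq_zero]
  · congr 1
    funext x
    fin_cases i
    · refine Eq.trans ?_ (hp.1 _)
      congr 1
      ext j
      fin_cases j <;> simp [Fin.insertNth, Fin.succAboveCases, EuclideanSpace.single] <;> rfl
    · refine Eq.trans ?_ (hp.2 _)
      congr 1
      ext j
      fin_cases j <;> simp [Fin.insertNth, Fin.succAboveCases, EuclideanSpace.single]
    · exact absurd rfl hi
  · intro j
    fin_cases j <;> simp [hL₁.le, hL₂.le, hb.le]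

theorem aux_div3_ver (L₁ L₂ b : ℝ) (hL₁ : 0 < L₁) (hL₂ : 0 < L₂) (hb : 0 < b)
    (f : E3 → ℝ) (hf : ContDiff ℝ 1 f) : ∫ x in Q3 L₁ L₂ b, pd3 2 f x =
      (∫ x in Q2 L₁ L₂, f (emb 0 x)) - ∫ x in Q2 L₁ L₂, f (emb (-b) x) := by
  rw [aux_int_Q3, aux_int_Q2, aux_int_Q2]
  simp only [pd3, ← aux_fderiv_toLp f hf]
  rw [aux_box _ _ _ _ (aux_contDiff_toLp f hf)]
  · have e1 : (![0, 0, -b] : Fin 3 → ℝ) ∘ Fin.succAbove 2 = ![0, 0] := by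
      ext j; fin_cases j <;> rfl
    have e2 : (![L₁, L₂, 0] : Fin 3 → ℝ) ∘ Fin.succAbove 2 = ![L₁, L₂] := by
      ext j; fin_cases j <;> rfl
    have e3 : ∀ (z : ℝ) (y : Fin 2 → ℝ), (WithLp.toLp 2 (Fin.insertNth (2 : Fin 3) z y) : E3) =
        emb z (WithLp.toLp 2 y) := by
      intro z y
      ext j
      fin_cases j <;> rfl
    rw [e1, e2]
    simp only [e3]
    rfl
  · intro j
    fin_cases j <;> simp [hL₁.le, hL₂.le, hb.le]

/-- Differentiation under the integral sign over a compact set. -/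
theorem aux_param {E : Type*} [NormedAddCommGroup E] [NormedSpace ℝ E] [MeasurableSpace E]
    [BorelSpace E] [SecondCountableTopology E] (μ : Measure E) [IsFiniteMeasureOnCompacts μ]
    (K : Set E) (hK : IsCompact K) (F : ℝ × E → ℝ) (hF : ContDiff ℝ 1 F) (t : ℝ) :
    HasDerivAt (fun s => ∫ x in K, F (s, x) ∂μ) (∫ x in K, fderiv ℝ F (t, x) (1, 0) ∂μ) t := by
  have hc : Continuous fun p : ℝ × E => fderiv ℝ F p (1, 0) :=
    (hF.continuous_fderiv (by norm_num)).clm_apply continuous_const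
  obtain ⟨C, hC⟩ := ((isCompact_Icc (a := t - 1) (b := t + 1)).prod hK).exists_bound_of_continuousOn
    hc.continuousOn
  have hfin : IsFiniteMeasure (μ.restrict K) := ⟨by simpa using hK.measure_lt_top⟩
  refine (hasDerivAt_integral_of_dominated_loc_of_deriv_le (F := fun s x => F (s, x))
    (F' := fun s x => fderiv ℝ F (s, x) (1, 0)) (bound := fun _ => C)
    (Icc_mem_nhds (by linarith : t - 1 < t) (by linarith : t < t + 1)) ?_ ?_ ?_ ?_ ?_ ?_).2
  · refine Filter.Eventually.of_forall fun s => ?_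
    exact (hF.continuous.comp (by fun_prop)).aestronglyMeasurable
  · exact ((hF.continuous.comp (by fun_prop : Continuous fun x : E => (t, x))).continuousOn).integrableOn_compact hK
  · exact (hc.comp (by fun_prop : Continuous fun x : E => (t, x))).aestronglyMeasurable
  · refine (ae_restrict_iff' hK.measurableSet).2 (Filter.Eventually.of_forall ?_)
    intro x hx s hs
    exact hC (s, x) ⟨hs, hx⟩
  · exact integrable_const _
  · refine Filter.Eventually.of_forall fun x s _ => ?_
    have h1 : HasDerivAt (fun s : ℝ => (s, x)) ((1 : ℝ), (0 : E)) s :=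
      (hasDerivAt_id s).prodMk (hasDerivAt_const s x)
    exact ((hF.differentiable (by norm_num)) (s, x)).hasFDerivAt.comp_hasDerivAt s h1

theorem aux_cd_dir {E : Type*} [NormedAddCommGroup E] [NormedSpace ℝ E] (f : E → ℝ)
    (hf : ContDiff ℝ (⊤ : ℕ∞) f) (w : E) : ContDiff ℝ (⊤ : ℕ∞) (fun x => fderiv ℝ f x w) :=
  (hf.fderiv_right (m := (⊤ : ℕ∞)) (by simp)).clm_apply contDiff_const

theorem aux_dir_comm {E : Type*} [NormedAddCommGroup E] [NormedSpace ℝ E] (f : E → ℝ)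
    (hf : ContDiff ℝ (⊤ : ℕ∞) f) (w u : E) (x : E) :
    fderiv ℝ (fun y => fderiv ℝ f y w) x u = fderiv ℝ (fun y => fderiv ℝ f y u) x w := by
  have hd : DifferentiableAt ℝ (fderiv ℝ f) x :=
    ((hf.fderiv_right (m := (⊤ : ℕ∞)) (by simp)).differentiable (by simp)) x
  have h1 : ∀ w : E, fderiv ℝ (fun y => fderiv ℝ f y w) x = (fderiv ℝ (fderiv ℝ f) x).flip w := by
    intro w
    rw [fderiv_clm_apply hd (differentiableAt_const w)]
    simp
  rw [h1, h1]
  simp only [ContinuousLinearMap.flip_apply]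
  exact (hf.contDiffAt.isSymmSndFDerivAt (by
    simp only [minSmoothness_of_isRCLikeNormedField]
    exact WithTop.coe_le_coe.2 (le_top : (2 : ℕ∞) ≤ ⊤))) u w

theorem aux_slice {E : Type*} [NormedAddCommGroup E] [NormedSpace ℝ E] (F : ℝ × E → ℝ)
    (hF : ContDiff ℝ (⊤ : ℕ∞) F) (t : ℝ) (x w : E) :
    fderiv ℝ (fun y => F (t, y)) x w = fderiv ℝ F (t, x) (0, w) := by
  have h1 : HasFDerivAt (fun y : E => (t, y)) (ContinuousLinearMap.inr ℝ ℝ E) x :=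
    hasFDerivAt_prodMk_right t x
  have h2 := (((hF.differentiable (by simp)) (t, x)).hasFDerivAt.comp x h1).fderiv
  rw [show (fun y => F (t, y)) = F ∘ (fun y : E => (t, y)) from rfl, h2]
  simp

theorem aux_time {E : Type*} [NormedAddCommGroup E] [NormedSpace ℝ E] (F : ℝ × E → ℝ)
    (hF : ContDiff ℝ (⊤ : ℕ∞) F) (t : ℝ) (x : E) :
    HasDerivAt (fun s => F (s, x)) (fderiv ℝ F (t, x) (1, 0)) t := by
  have h1 : HasDerivAt (fun s : ℝ => (s, x)) ((1 : ℝ), (0 : E)) t :=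
    (hasDerivAt_id t).prodMk (hasDerivAt_const t x)
  exact ((hF.differentiable (by simp)) (t, x)).hasFDerivAt.comp_hasDerivAt t h1

theorem aux_per {E : Type*} [NormedAddCommGroup E] [NormedSpace ℝ E] (f : E → ℝ) (a : E)
    (h : ∀ x, f (x + a) = f x) (w x : E) : fderiv ℝ f (x + a) w = fderiv ℝ f x w := by
  rw [← fderiv_comp_add_right a]
  simp only [h]

theorem aux_per2 {L₁ L₂ : ℝ} {f : E2 → ℝ} (h : PeriodicE2 L₁ L₂ f) (i : Fin 2) :
    PeriodicE2 L₁ L₂ (pd i f) :=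
  ⟨fun x => aux_per f _ h.1 _ x, fun x => aux_per f _ h.2 _ x⟩

theorem aux_per3 {L₁ L₂ : ℝ} {f : E3 → ℝ} (h : PeriodicE3 L₁ L₂ f) (i : Fin 3) :
    PeriodicE3 L₁ L₂ (pd3 i f) :=
  ⟨fun x => aux_per f _ h.1 _ x, fun x => aux_per f _ h.2 _ x⟩

theorem aux_cd_pd {f : E2 → ℝ} (hf : ContDiff ℝ (⊤ : ℕ∞) f) (i : Fin 2) :
    ContDiff ℝ (⊤ : ℕ∞) (pd i f) := aux_cd_dir f hf _

theorem aux_cd_pd3 {f : E3 → ℝ} (hf : ContDiff ℝ (⊤ : ℕ∞) f) (i : Fin 3) :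
    ContDiff ℝ (⊤ : ℕ∞) (pd3 i f) := aux_cd_dir f hf _

theorem aux_pd_add {f g : E2 → ℝ} (hf : ContDiff ℝ (⊤ : ℕ∞) f) (hg : ContDiff ℝ (⊤ : ℕ∞) g)
    (i : Fin 2) (x : E2) : pd i (fun y => f y + g y) x = pd i f x + pd i g x := by
  unfold pd
  rw [fderiv_fun_add (hf.differentiable (by simp) x) (hg.differentiable (by simp) x)]
  rfl

theorem aux_pd_mul {f g : E2 → ℝ} (hf : ContDiff ℝ (⊤ : ℕ∞) f) (hg : ContDiff ℝ (⊤ : ℕ∞) g)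
    (i : Fin 2) (x : E2) : pd i (fun y => f y * g y) x = pd i f x * g x + f x * pd i g x := by
  unfold pd
  rw [fderiv_fun_mul (hf.differentiable (by simp) x) (hg.differentiable (by simp) x)]
  simp
  ring

theorem aux_pd_const_mul {f : E2 → ℝ} (hf : ContDiff ℝ (⊤ : ℕ∞) f) (c : ℝ)
    (i : Fin 2) (x : E2) : pd i (fun y => c * f y) x = c * pd i f x := by
  unfold pd
  rw [fderiv_const_mul (hf.differentiable (by simp) x)]
  simp

theorem aux_pd3_add {f g : E3 → ℝ} (hf : ContDiff ℝ (⊤ : ℕ∞) f) (hg : ContDiff ℝ (⊤ : ℕ∞) g)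
    (i : Fin 3) (x : E3) : pd3 i (fun y => f y + g y) x = pd3 i f x + pd3 i g x := by
  unfold pd3
  rw [fderiv_fun_add (hf.differentiable (by simp) x) (hg.differentiable (by simp) x)]
  rfl

theorem aux_pd3_sub {f g : E3 → ℝ} (hf : ContDiff ℝ (⊤ : ℕ∞) f) (hg : ContDiff ℝ (⊤ : ℕ∞) g)
    (i : Fin 3) (x : E3) : pd3 i (fun y => f y - g y) x = pd3 i f x - pd3 i g x := by
  unfold pd3
  rw [fderiv_fun_sub (hf.differentiable (by simp) x) (hg.differentiable (by simp) x)]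
  rfl

theorem aux_pd3_mul {f g : E3 → ℝ} (hf : ContDiff ℝ (⊤ : ℕ∞) f) (hg : ContDiff ℝ (⊤ : ℕ∞) g)
    (i : Fin 3) (x : E3) : pd3 i (fun y => f y * g y) x = pd3 i f x * g x + f x * pd3 i g x := by
  unfold pd3
  rw [fderiv_fun_mul (hf.differentiable (by simp) x) (hg.differentiable (by simp) x)]
  simp
  ring

theorem aux_pd3_comm {f : E3 → ℝ} (hf : ContDiff ℝ (⊤ : ℕ∞) f) (i j : Fin 3) (x : E3) :
    pd3 i (pd3 j f) x = pd3 j (pd3 i f) x :=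
  aux_dir_comm f hf _ _ x

/-- The embedding as an affine map. -/
theorem aux_emb_hasFDerivAt (z : ℝ) (x : E2) :
    ∃ T : E2 →L[ℝ] E3, HasFDerivAt (emb z) T x ∧
      T (EuclideanSpace.single 0 1) = EuclideanSpace.single 0 1 ∧
      T (EuclideanSpace.single 1 1) = EuclideanSpace.single 1 1 := by
  let T : E2 →ₗ[ℝ] E3 :=
    { toFun := emb 0
      map_add' := by
        intro x y
        ext j
        fin_cases j <;> simp [emb]
      map_smul' := by
        intro c x
        ext j
        fin_cases j <;> simp [emb] }
  let T' : E2 →L[ℝ] E3 := LinearMap.toContinuousLinearMap T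
  refine ⟨T', ?_, ?_, ?_⟩
  · have h : emb z = fun y => T' y + emb z 0 := by
      funext y
      ext j
      fin_cases j <;> simp [T', T, emb]
    rw [h]
    exact T'.hasFDerivAt.add_const _
  · ext j
    fin_cases j <;> simp [T', T, emb]
  · ext j
    fin_cases j <;> simp [T', T, emb]

theorem aux_emb_contDiff (z : ℝ) : ContDiff ℝ (⊤ : ℕ∞) (emb z) := by
  refine (EuclideanSpace.equiv (Fin 3) ℝ).symm.contDiff.comp ?_
  rw [contDiff_pi]
  intro j
  fin_cases j <;> simp <;> fun_prop

theorem aux_pd_emb (z : ℝ) {f : E3 → ℝ} (hf : ContDiff ℝ (⊤ : ℕ∞) f) (x : E2) :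
    pd 0 (fun y => f (emb z y)) x = pd3 0 f (emb z x) ∧
    pd 1 (fun y => f (emb z y)) x = pd3 1 f (emb z x) := by
  obtain ⟨T, hT, h0, h1⟩ := aux_emb_hasFDerivAt z x
  have h2 := ((hf.differentiable (by simp) (emb z x)).hasFDerivAt.comp x hT).fderiv
  have h3 : fderiv ℝ (fun y => f (emb z y)) x = (fderiv ℝ f (emb z x)).comp T := h2
  unfold pd pd3
  rw [h3]
  simp [h0, h1]

theorem aux_per_emb {L₁ L₂ : ℝ} (z : ℝ) {f : E3 → ℝ} (hf : PeriodicE3 L₁ L₂ f) :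
    PeriodicE2 L₁ L₂ (fun x => f (emb z x)) := by
  constructor
  · intro x
    refine Eq.trans ?_ (hf.1 (emb z x))
    beta_reduce
    congr 1
    ext j
    fin_cases j <;> simp [emb]
  · intro x
    refine Eq.trans ?_ (hf.2 (emb z x))
    beta_reduce
    congr 1
    ext j
    fin_cases j <;> simp [emb]

theorem aux_PeriodicE3_add {L₁ L₂ : ℝ} {f g : E3 → ℝ} (hf : PeriodicE3 L₁ L₂ f)
    (hg : PeriodicE3 L₁ L₂ g) : PeriodicE3 L₁ L₂ (fun x => f x + g x) :=
  ⟨fun x => by simp only [hf.1, hg.1], fun x => by simp only [hf.2, hg.2]⟩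

theorem aux_PeriodicE3_sub {L₁ L₂ : ℝ} {f g : E3 → ℝ} (hf : PeriodicE3 L₁ L₂ f)
    (hg : PeriodicE3 L₁ L₂ g) : PeriodicE3 L₁ L₂ (fun x => f x - g x) :=
  ⟨fun x => by simp only [hf.1, hg.1], fun x => by simp only [hf.2, hg.2]⟩

theorem aux_PeriodicE3_mul {L₁ L₂ : ℝ} {f g : E3 → ℝ} (hf : PeriodicE3 L₁ L₂ f)
    (hg : PeriodicE3 L₁ L₂ g) : PeriodicE3 L₁ L₂ (fun x => f x * g x) :=
  ⟨fun x => by simp only [hf.1, hg.1], fun x => by simp only [hf.2, hg.2]⟩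

/-- The flux `v · (𝔻v - q I) e_j`. -/
noncomputable def auxG (V : Fin 3 → E3 → ℝ) (Q : E3 → ℝ) (j : Fin 3) : E3 → ℝ := fun x =>
  V 0 x * (pd3 0 (V j) x + pd3 j (V 0) x) + V 1 x * (pd3 1 (V j) x + pd3 j (V 1) x)
    + V 2 x * (pd3 2 (V j) x + pd3 j (V 2) x) - V j x * Q x

theorem auxG_contDiff {V : Fin 3 → E3 → ℝ} {Q : E3 → ℝ}
    (hV : ∀ i, ContDiff ℝ (⊤ : ℕ∞) (V i)) (hQ : ContDiff ℝ (⊤ : ℕ∞) Q) (j : Fin 3) :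
    ContDiff ℝ (⊤ : ℕ∞) (auxG V Q j) := by
  have hp : ∀ i j, ContDiff ℝ (⊤ : ℕ∞) (pd3 i (V j)) := fun i j => aux_cd_pd3 (hV j) i
  unfold auxG
  exact ((((hV 0).mul ((hp 0 j).add (hp j 0))).add ((hV 1).mul ((hp 1 j).add (hp j 1)))).add
    ((hV 2).mul ((hp 2 j).add (hp j 2)))).sub ((hV j).mul hQ)

theorem auxG_periodic {L₁ L₂ : ℝ} {V : Fin 3 → E3 → ℝ} {Q : E3 → ℝ}
    (hV : ∀ i, PeriodicE3 L₁ L₂ (V i)) (hQ : PeriodicE3 L₁ L₂ Q) (j : Fin 3) :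
    PeriodicE3 L₁ L₂ (auxG V Q j) := by
  have hp : ∀ i j, PeriodicE3 L₁ L₂ (pd3 i (V j)) := fun i j => aux_per3 (hV j) i
  unfold auxG
  refine aux_PeriodicE3_sub (aux_PeriodicE3_add (aux_PeriodicE3_add ?_ ?_) ?_) ?_
  · exact aux_PeriodicE3_mul (hV 0) (aux_PeriodicE3_add (hp 0 j) (hp j 0))
  · exact aux_PeriodicE3_mul (hV 1) (aux_PeriodicE3_add (hp 1 j) (hp j 1))
  · exact aux_PeriodicE3_mul (hV 2) (aux_PeriodicE3_add (hp 2 j) (hp j 2))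
  · exact aux_PeriodicE3_mul (hV j) hQ

theorem auxG_pd3 {V : Fin 3 → E3 → ℝ} {Q : E3 → ℝ}
    (hV : ∀ i, ContDiff ℝ (⊤ : ℕ∞) (V i)) (hQ : ContDiff ℝ (⊤ : ℕ∞) Q) (j k : Fin 3) (x : E3) :
    pd3 k (auxG V Q j) x =
      (pd3 k (V 0) x * (pd3 0 (V j) x + pd3 j (V 0) x)
        + V 0 x * (pd3 k (pd3 0 (V j)) x + pd3 k (pd3 j (V 0)) x))
      + (pd3 k (V 1) x * (pd3 1 (V j) x + pd3 j (V 1) x)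
        + V 1 x * (pd3 k (pd3 1 (V j)) x + pd3 k (pd3 j (V 1)) x))
      + (pd3 k (V 2) x * (pd3 2 (V j) x + pd3 j (V 2) x)
        + V 2 x * (pd3 k (pd3 2 (V j)) x + pd3 k (pd3 j (V 2)) x))
      - (pd3 k (V j) x * Q x + V j x * pd3 k Q x) := by
  have hp : ∀ i j, ContDiff ℝ (⊤ : ℕ∞) (pd3 i (V j)) := fun i j => aux_cd_pd3 (hV j) i
  have hm : ∀ i, ContDiff ℝ (⊤ : ℕ∞) (fun x => V i x * (pd3 i (V j) x + pd3 j (V i) x)) :=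
    fun i => (hV i).mul ((hp i j).add (hp j i))
  have hmd : ∀ i, pd3 k (fun x => V i x * (pd3 i (V j) x + pd3 j (V i) x)) x =
      pd3 k (V i) x * (pd3 i (V j) x + pd3 j (V i) x)
        + V i x * (pd3 k (pd3 i (V j)) x + pd3 k (pd3 j (V i)) x) := by
    intro i
    rw [aux_pd3_mul (hV i) ((hp i j).add (hp j i)), aux_pd3_add (hp i j) (hp j i)]
  unfold auxG
  rw [aux_pd3_sub (((hm 0).add (hm 1)).add (hm 2)) ((hV j).mul hQ),
    aux_pd3_add ((hm 0).add (hm 1)) (hm 2), aux_pd3_add (hm 0) (hm 1), hmd, hmd, hmd,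
    aux_pd3_mul (hV j) hQ]

theorem aux_part3 (L₁ L₂ b : ℝ) (hL₁ : 0 < L₁) (hL₂ : 0 < L₂) (hb : 0 < b)
    (V A P1 : Fin 3 → E3 → ℝ) (Q P2 : E3 → ℝ)
    (hV : ∀ i, ContDiff ℝ (⊤ : ℕ∞) (V i)) (hQ : ContDiff ℝ (⊤ : ℕ∞) Q)
    (hP1 : ∀ i, Continuous (P1 i))
    (hVp : ∀ i, PeriodicE3 L₁ L₂ (V i)) (hQp : PeriodicE3 L₁ L₂ Q)
    (h1 : ∀ x i, A i x - (∑ j : Fin 3, pd3 j (pd3 j (V i)) x) + pd3 i Q x = P1 i x)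
    (h2 : ∀ x, (∑ i : Fin 3, pd3 i (V i) x) = P2 x)
    (h6 : ∀ x i, V i (emb (-b) x) = 0) :
    ∫ x in Q3 L₁ L₂ b, ∑ i : Fin 3, V i x * A i x =
      (∫ x in Q3 L₁ L₂ b, (∑ i : Fin 3, V i x * P1 i x) + Q x * P2 x
              - ∑ i : Fin 3, V i x * pd3 i P2 x)
      - (∫ x in Q3 L₁ L₂ b,
              (∑ i : Fin 3, ∑ j : Fin 3, (pd3 i (V j) x + pd3 j (V i) x) ^ 2) / 2)
      + ∫ x in Q2 L₁ L₂, auxG V Q 2 (emb 0 x) := by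
  have hp : ∀ i j, ContDiff ℝ (⊤ : ℕ∞) (pd3 i (V j)) := fun i j => aux_cd_pd3 (hV j) i
  have hP2 : P2 = fun x => pd3 0 (V 0) x + pd3 1 (V 1) x + pd3 2 (V 2) x := by
    funext x
    rw [← h2 x, Fin.sum_univ_three]
  have hP2s : ContDiff ℝ (⊤ : ℕ∞) P2 := by
    rw [hP2]
    exact ((hp 0 0).add (hp 1 1)).add (hp 2 2)
  have hP2d : ∀ i x, pd3 i P2 x =
      pd3 i (pd3 0 (V 0)) x + pd3 i (pd3 1 (V 1)) x + pd3 i (pd3 2 (V 2)) x := by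
    intro i x
    rw [hP2, aux_pd3_add ((hp 0 0).add (hp 1 1)) (hp 2 2), aux_pd3_add (hp 0 0) (hp 1 1)]
  have hGs := fun j => auxG_contDiff hV hQ j
  have hGp := fun j => auxG_periodic hVp hQp j
  have cV : ∀ i, Continuous (V i) := fun i => (hV i).continuous
  have cQ : Continuous Q := hQ.continuous
  have cP2 : Continuous P2 := hP2s.continuous
  have cp : ∀ i j, Continuous (pd3 i (V j)) := fun i j => (hp i j).continuous
  have cP2d : ∀ i, Continuous (pd3 i P2) := fun i => (aux_cd_pd3 hP2s i).continuous
  have cG : ∀ i, Continuous (pd3 i (auxG V Q i)) := fun i => (aux_cd_pd3 (hGs i) i).continuous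
  have iI : ∀ f : E3 → ℝ, Continuous f → IntegrableOn f (Q3 L₁ L₂ b) :=
    fun f hf => hf.continuousOn.integrableOn_compact (aux_compact_Q3 L₁ L₂ b)
  have hpt : ∀ x, ∑ i : Fin 3, V i x * A i x =
      (((∑ i : Fin 3, V i x * P1 i x) + Q x * P2 x - ∑ i : Fin 3, V i x * pd3 i P2 x)
      - (∑ i : Fin 3, ∑ j : Fin 3, (pd3 i (V j) x + pd3 j (V i) x) ^ 2) / 2)
      + ((pd3 0 (auxG V Q 0) x + pd3 1 (auxG V Q 1) x) + pd3 2 (auxG V Q 2) x) := by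
    intro x
    simp only [auxG_pd3 hV hQ, ← h1, hP2d, ← h2, Fin.sum_univ_three]
    rw [aux_pd3_comm (hV 0) 1 0, aux_pd3_comm (hV 0) 2 0, aux_pd3_comm (hV 1) 1 0,
      aux_pd3_comm (hV 1) 2 1, aux_pd3_comm (hV 2) 2 0, aux_pd3_comm (hV 2) 2 1]
    ring
  have i1 := iI (fun x => (∑ i : Fin 3, V i x * P1 i x) + Q x * P2 x
    - ∑ i : Fin 3, V i x * pd3 i P2 x) (by fun_prop)
  have i2 := iI (fun x => (∑ i : Fin 3, ∑ j : Fin 3, (pd3 i (V j) x + pd3 j (V i) x) ^ 2) / 2)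
    (by fun_prop)
  have i12 := iI (fun x => ((∑ i : Fin 3, V i x * P1 i x) + Q x * P2 x
    - ∑ i : Fin 3, V i x * pd3 i P2 x)
    - (∑ i : Fin 3, ∑ j : Fin 3, (pd3 i (V j) x + pd3 j (V i) x) ^ 2) / 2) (by fun_prop)
  have i3 := fun i => iI _ (cG i)
  have i4 : IntegrableOn (fun x => pd3 0 (auxG V Q 0) x + pd3 1 (auxG V Q 1) x) (Q3 L₁ L₂ b) :=
    (i3 0).add (i3 1)
  have i5 : IntegrableOn (fun x => (pd3 0 (auxG V Q 0) x + pd3 1 (auxG V Q 1) x)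
    + pd3 2 (auxG V Q 2) x) (Q3 L₁ L₂ b) := i4.add (i3 2)
  simp only [hpt]
  have one : ∀ j, ContDiff ℝ 1 (auxG V Q j) := fun j => (hGs j).of_le (by simp)
  have hz : ∀ x, auxG V Q 2 (emb (-b) x) = 0 := by
    intro x
    simp [auxG, h6]
  rw [integral_add i12 i5, integral_sub i1 i2, integral_add i4 (i3 2),
    integral_add (i3 0) (i3 1),
    aux_div3_hor L₁ L₂ b hL₁ hL₂ hb _ (one 0) (hGp 0) 0 (by decide),
    aux_div3_hor L₁ L₂ b hL₁ hL₂ hb _ (one 1) (hGp 1) 1 (by decide),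
    aux_div3_ver L₁ L₂ b hL₁ hL₂ hb _ (one 2)]
  simp [hz]

theorem aux_part2 (L₁ L₂ σ₀ σ₀' c₀ γ : ℝ) (hL₁ : 0 < L₁) (hL₂ : 0 < L₂) (hc₀ : 0 < c₀)
    (Z Zt H Ht P4 P5 G : E2 → ℝ) (W P3 : Fin 3 → E2 → ℝ)
    (hZ : ContDiff ℝ (⊤ : ℕ∞) Z) (hZt : ContDiff ℝ (⊤ : ℕ∞) Zt)
    (hH : ContDiff ℝ (⊤ : ℕ∞) H) (hW : ∀ i, ContDiff ℝ (⊤ : ℕ∞) (W i))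
    (cP3 : ∀ i, Continuous (P3 i)) (cP4 : Continuous P4) (cP5 : Continuous P5)
    (cG : Continuous G)
    (hZp : PeriodicE2 L₁ L₂ Z) (hZtp : PeriodicE2 L₁ L₂ Zt)
    (hHp : PeriodicE2 L₁ L₂ H) (hWp : ∀ i, PeriodicE2 L₁ L₂ (W i))
    (h3 : ∀ x, G x = - (∑ i : Fin 3, W i x * P3 i x) - W 2 x * (Z x - σ₀ * lap2 Z x)
      + σ₀' * (W 0 x * pd 0 H x + W 1 x * pd 1 H x))
    (h4 : ∀ x, Zt x - W 2 x = P4 x)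
    (h5 : ∀ x, Ht x + c₀ * (pd 0 (W 0) x + pd 1 (W 1) x) - γ * lap2 H x = P5 x) :
    ∫ x in Q2 L₁ L₂, (Z x * Zt x + σ₀ * (pd 0 Z x * pd 0 Zt x + pd 1 Z x * pd 1 Zt x)
        + (-σ₀' / c₀) * (H x * Ht x)) =
      (∫ x in Q2 L₁ L₂, (-(∑ i : Fin 3, W i x * P3 i x) + Z x * P4 x
                - σ₀ * P4 x * lap2 Z x - (σ₀' / c₀) * P5 x * H x))
      - (-γ * σ₀' / c₀) * (∫ x in Q2 L₁ L₂, ((pd 0 H x) ^ 2 + (pd 1 H x) ^ 2))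
      - ∫ x in Q2 L₁ L₂, G x := by
  let F : Fin 2 → E2 → ℝ := fun j x => σ₀ * (Zt x * pd j Z x) + (-σ₀' * γ / c₀) * (H x * pd j H x)
    + σ₀' * (W j.castSucc x * H x)
  have hpZ := fun j => aux_cd_pd hZ j
  have hpH := fun j => aux_cd_pd hH j
  have f1 : ∀ j, ContDiff ℝ (⊤ : ℕ∞) (fun x => Zt x * pd j Z x) := fun j => hZt.mul (hpZ j)
  have f2 : ∀ j, ContDiff ℝ (⊤ : ℕ∞) (fun x => H x * pd j H x) := fun j => hH.mul (hpH j)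
  have f3 : ∀ j : Fin 2, ContDiff ℝ (⊤ : ℕ∞) (fun x => W j.castSucc x * H x) :=
    fun j => (hW _).mul hH
  have g1 : ∀ j, ContDiff ℝ (⊤ : ℕ∞) (fun x => σ₀ * (Zt x * pd j Z x)) :=
    fun j => contDiff_const.mul (f1 j)
  have g2 : ∀ j, ContDiff ℝ (⊤ : ℕ∞) (fun x => (-σ₀' * γ / c₀) * (H x * pd j H x)) :=
    fun j => contDiff_const.mul (f2 j)
  have g3 : ∀ j : Fin 2, ContDiff ℝ (⊤ : ℕ∞) (fun x => σ₀' * (W j.castSucc x * H x)) :=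
    fun j => contDiff_const.mul (f3 j)
  have hF : ∀ j, ContDiff ℝ (⊤ : ℕ∞) (F j) := fun j => ((g1 j).add (g2 j)).add (g3 j)
  have hFp : ∀ j, PeriodicE2 L₁ L₂ (F j) := by
    intro j
    have a := aux_per2 hZp j
    have b := aux_per2 hHp j
    constructor
    · intro x
      simp only [F, hZtp.1, a.1, hHp.1, b.1, (hWp _).1]
    · intro x
      simp only [F, hZtp.2, a.2, hHp.2, b.2, (hWp _).2]
  have hFd : ∀ j x, pd j (F j) x = σ₀ * (pd j Zt x * pd j Z x + Zt x * pd j (pd j Z) x)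
      + (-σ₀' * γ / c₀) * (pd j H x * pd j H x + H x * pd j (pd j H) x)
      + σ₀' * (pd j (W j.castSucc) x * H x + W j.castSucc x * pd j H x) := by
    intro j x
    simp only [F]
    rw [aux_pd_add ((g1 j).add (g2 j)) (g3 j), aux_pd_add (g1 j) (g2 j),
      aux_pd_const_mul (f1 j), aux_pd_const_mul (f2 j), aux_pd_const_mul (f3 j),
      aux_pd_mul hZt (hpZ j), aux_pd_mul hH (hpH j), aux_pd_mul (hW _) hH]
  have cF : ∀ j, Continuous (pd j (F j)) := fun j => (aux_cd_pd (hF j) j).continuous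
  have cW : ∀ i, Continuous (W i) := fun i => (hW i).continuous
  have cZ := hZ.continuous
  have cH := hH.continuous
  have cpH : ∀ j, Continuous (pd j H) := fun j => (hpH j).continuous
  have cL : Continuous (lap2 Z) :=
    (aux_cd_pd (hpZ 0) 0).continuous.add (aux_cd_pd (hpZ 1) 1).continuous
  have iI : ∀ f : E2 → ℝ, Continuous f → IntegrableOn f (Q2 L₁ L₂) :=
    fun f hf => hf.continuousOn.integrableOn_compact (aux_compact_Q2 L₁ L₂)
  have hpt : ∀ x, Z x * Zt x + σ₀ * (pd 0 Z x * pd 0 Zt x + pd 1 Z x * pd 1 Zt x)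
        + (-σ₀' / c₀) * (H x * Ht x) =
      (((-(∑ i : Fin 3, W i x * P3 i x) + Z x * P4 x
                - σ₀ * P4 x * lap2 Z x - (σ₀' / c₀) * P5 x * H x)
      - (-γ * σ₀' / c₀) * ((pd 0 H x) ^ 2 + (pd 1 H x) ^ 2))
      - G x) + (pd 0 (F 0) x + pd 1 (F 1) x) := by
    intro x
    have e0 : W (Fin.castSucc (0 : Fin 2)) = W 0 := rfl
    have e1 : W (Fin.castSucc (1 : Fin 2)) = W 1 := rfl
    simp only [hFd, h3, ← h4, ← h5, lap2, e0, e1]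
    field_simp
    ring
  have i1 := iI (fun x => -(∑ i : Fin 3, W i x * P3 i x) + Z x * P4 x
                - σ₀ * P4 x * lap2 Z x - (σ₀' / c₀) * P5 x * H x) (by fun_prop)
  have i2 := iI (fun x => (-γ * σ₀' / c₀) * ((pd 0 H x) ^ 2 + (pd 1 H x) ^ 2)) (by fun_prop)
  have i12 := iI (fun x => (-(∑ i : Fin 3, W i x * P3 i x) + Z x * P4 x
                - σ₀ * P4 x * lap2 Z x - (σ₀' / c₀) * P5 x * H x)
                - (-γ * σ₀' / c₀) * ((pd 0 H x) ^ 2 + (pd 1 H x) ^ 2)) (by fun_prop)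
  have i3 := iI _ cG
  have i123 := iI (fun x => ((-(∑ i : Fin 3, W i x * P3 i x) + Z x * P4 x
                - σ₀ * P4 x * lap2 Z x - (σ₀' / c₀) * P5 x * H x)
                - (-γ * σ₀' / c₀) * ((pd 0 H x) ^ 2 + (pd 1 H x) ^ 2)) - G x) (by fun_prop)
  have i4 := fun j => iI _ (cF j)
  have i5 : IntegrableOn (fun x => pd 0 (F 0) x + pd 1 (F 1) x) (Q2 L₁ L₂) := (i4 0).add (i4 1)
  have one : ∀ j, ContDiff ℝ 1 (F j) := fun j => (hF j).of_le (by simp)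
  simp only [hpt]
  rw [integral_add i123 i5, integral_sub i12 i3, integral_sub i1 i2,
    integral_add (i4 0) (i4 1), aux_div2 L₁ L₂ hL₁ hL₂ _ (one 0) (hFp 0) 0,
    aux_div2 L₁ L₂ hL₁ hL₂ _ (one 1) (hFp 1) 1, integral_const_mul]
  ring

/-- Energy-dissipation identity for the linearized surfactant system
(Proposition on the perturbed linear form): if (v, q, ζ, h) solves the system with
forcing terms Φ¹,…,Φ⁵, then
d/dt [ ∫ |v|²/2 + ∫ (|ζ|²/2 + σ₀|∇_*ζ|²/2 − σ₀′|h|²/(2c₀)) ] + ∫ |𝔻v|²/2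
  + (−γσ₀′/c₀) ∫ |∇_*h|²
  = ∫ (v·Φ¹ + qΦ² − v·∇Φ²) + ∫ (−v·Φ³ + ζΦ⁴ − σ₀Φ⁴Δ_*ζ − (σ₀′/c₀)Φ⁵h). -/
theorem linearized_energy_dissipation
    (b L₁ L₂ σ₀ σ₀' c₀ γ : ℝ)
    (hb : 0 < b) (hL₁ : 0 < L₁) (hL₂ : 0 < L₂)
    (hσ₀ : 0 < σ₀) (hσ₀' : σ₀' < 0) (hc₀ : 0 < c₀) (hγ : 0 < γ)
    (v : ℝ → E3 → Fin 3 → ℝ) (q : ℝ → E3 → ℝ)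
    (Φ1 : ℝ → E3 → Fin 3 → ℝ) (Φ2 : ℝ → E3 → ℝ)
    (ζ h Φ4 Φ5 : ℝ → E2 → ℝ) (Φ3 : ℝ → E2 → Fin 3 → ℝ)
    -- smoothness
    (hv : ContDiff ℝ (⊤ : ℕ∞) (fun p : ℝ × E3 => v p.1 p.2))
    (hq : ContDiff ℝ (⊤ : ℕ∞) (fun p : ℝ × E3 => q p.1 p.2))
    (hΦ1 : ContDiff ℝ (⊤ : ℕ∞) (fun p : ℝ × E3 => Φ1 p.1 p.2))
    (hΦ2 : ContDiff ℝ (⊤ : ℕ∞) (fun p : ℝ × E3 => Φ2 p.1 p.2))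
    (hζ : ContDiff ℝ (⊤ : ℕ∞) (fun p : ℝ × E2 => ζ p.1 p.2))
    (hh : ContDiff ℝ (⊤ : ℕ∞) (fun p : ℝ × E2 => h p.1 p.2))
    (hΦ3 : ContDiff ℝ (⊤ : ℕ∞) (fun p : ℝ × E2 => Φ3 p.1 p.2))
    (hΦ4 : ContDiff ℝ (⊤ : ℕ∞) (fun p : ℝ × E2 => Φ4 p.1 p.2))
    (hΦ5 : ContDiff ℝ (⊤ : ℕ∞) (fun p : ℝ × E2 => Φ5 p.1 p.2))
    -- horizontal periodicity
    (hvp : ∀ t i, PeriodicE3 L₁ L₂ (fun x => v t x i))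
    (hqp : ∀ t, PeriodicE3 L₁ L₂ (q t))
    (hΦ1p : ∀ t i, PeriodicE3 L₁ L₂ (fun x => Φ1 t x i))
    (hΦ2p : ∀ t, PeriodicE3 L₁ L₂ (Φ2 t))
    (hζp : ∀ t, PeriodicE2 L₁ L₂ (ζ t))
    (hhp : ∀ t, PeriodicE2 L₁ L₂ (h t))
    (hΦ3p : ∀ t i, PeriodicE2 L₁ L₂ (fun x => Φ3 t x i))
    (hΦ4p : ∀ t, PeriodicE2 L₁ L₂ (Φ4 t))
    (hΦ5p : ∀ t, PeriodicE2 L₁ L₂ (Φ5 t))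
    -- the equations
    (heq1 : ∀ t (x : E3) (i : Fin 3),
      deriv (fun s => v s x i) t
        - (∑ j : Fin 3, pd3 j (pd3 j (fun y => v t y i)) x)
        + pd3 i (q t) x = Φ1 t x i)
    (heq2 : ∀ t (x : E3), (∑ i : Fin 3, pd3 i (fun y => v t y i) x) = Φ2 t x)
    (heq3 : ∀ t (x : E2) (i : Fin 3),
      (if i = 2 then q t (emb 0 x) else 0)
        - (pd3 i (fun y => v t y 2) (emb 0 x) + pd3 2 (fun y => v t y i) (emb 0 x))
        - (if i = 2 then ζ t x - σ₀ * lap2 (ζ t) x else 0)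
        + σ₀' * (![pd 0 (h t) x, pd 1 (h t) x, 0] i)
        = Φ3 t x i)
    (heq4 : ∀ t (x : E2),
      deriv (fun s => ζ s x) t - v t (emb 0 x) 2 = Φ4 t x)
    (heq5 : ∀ t (x : E2),
      deriv (fun s => h s x) t
        + c₀ * (pd3 0 (fun y => v t y 0) (emb 0 x) + pd3 1 (fun y => v t y 1) (emb 0 x))
        - γ * lap2 (h t) x = Φ5 t x)
    (heq6 : ∀ t (x : E2) (i : Fin 3), v t (emb (-b) x) i = 0) :
    ∀ t, HasDerivAt
      (fun s =>
        (∫ x in Q3 L₁ L₂ b, (∑ i : Fin 3, (v s x i) ^ 2) / 2)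
          + ∫ x in Q2 L₁ L₂,
              ((ζ s x) ^ 2 / 2
                + σ₀ * ((pd 0 (ζ s) x) ^ 2 + (pd 1 (ζ s) x) ^ 2) / 2
                + (-σ₀' / (2 * c₀)) * (h s x) ^ 2))
      (((∫ x in Q3 L₁ L₂ b,
            (∑ i : Fin 3, v t x i * Φ1 t x i) + q t x * Φ2 t x
              - ∑ i : Fin 3, v t x i * pd3 i (Φ2 t) x)
          + ∫ x in Q2 L₁ L₂,
              (-(∑ i : Fin 3, v t (emb 0 x) i * Φ3 t x i)
                + ζ t x * Φ4 t x
                - σ₀ * Φ4 t x * lap2 (ζ t) x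
                - (σ₀' / c₀) * Φ5 t x * h t x))
        - ((∫ x in Q3 L₁ L₂ b,
              (∑ i : Fin 3, ∑ j : Fin 3,
                (pd3 i (fun y => v t y j) x + pd3 j (fun y => v t y i) x) ^ 2) / 2)
            + (-γ * σ₀' / c₀)
              * ∫ x in Q2 L₁ L₂, ((pd 0 (h t) x) ^ 2 + (pd 1 (h t) x) ^ 2))) t := by
  intro t
  -- joint smoothness
  have hvi : ∀ i, ContDiff ℝ (⊤ : ℕ∞) (fun p : ℝ × E3 => v p.1 p.2 i) := fun i => contDiff_pi.1 hv i
  have hΦ1i : ∀ i, ContDiff ℝ (⊤ : ℕ∞) (fun p : ℝ × E3 => Φ1 p.1 p.2 i) :=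
    fun i => contDiff_pi.1 hΦ1 i
  have hΦ3i : ∀ i, ContDiff ℝ (⊤ : ℕ∞) (fun p : ℝ × E2 => Φ3 p.1 p.2 i) :=
    fun i => contDiff_pi.1 hΦ3 i
  have s3 : ContDiff ℝ (⊤ : ℕ∞) (fun x : E3 => (t, x)) := contDiff_prodMk_right t
  have s2 : ContDiff ℝ (⊤ : ℕ∞) (fun x : E2 => (t, x)) := contDiff_prodMk_right t
  have hV : ∀ i, ContDiff ℝ (⊤ : ℕ∞) (fun x => v t x i) := fun i => (hvi i).comp s3
  have hQ : ContDiff ℝ (⊤ : ℕ∞) (q t) := hq.comp s3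
  have hZ : ContDiff ℝ (⊤ : ℕ∞) (ζ t) := hζ.comp s2
  have hH : ContDiff ℝ (⊤ : ℕ∞) (h t) := hh.comp s2
  have vt : ∀ x i, HasDerivAt (fun s => v s x i) (deriv (fun s => v s x i) t) t := fun x i =>
    (aux_time _ (hvi i) t x).differentiableAt.hasDerivAt
  have ζt : ∀ x, HasDerivAt (fun s => ζ s x) (deriv (fun s => ζ s x) t) t := fun x =>
    (aux_time _ hζ t x).differentiableAt.hasDerivAt
  have ht : ∀ x, HasDerivAt (fun s => h s x) (deriv (fun s => h s x) t) t := fun x =>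
    (aux_time _ hh t x).differentiableAt.hasDerivAt
  -- the bulk energy
  have cF3 : ContDiff ℝ (⊤ : ℕ∞) (fun p : ℝ × E3 => (∑ i : Fin 3, (v p.1 p.2 i) ^ 2) / 2) :=
    (ContDiff.sum fun i _ => (hvi i).pow 2).div_const 2
  have D3 := aux_param (volume : Measure E3) _ (aux_compact_Q3 L₁ L₂ b) _ (cF3.of_le (by simp)) t
  have e3 : ∀ x : E3, fderiv ℝ (fun p : ℝ × E3 => (∑ i : Fin 3, (v p.1 p.2 i) ^ 2) / 2) (t, x) (1, 0)
      = ∑ i : Fin 3, v t x i * deriv (fun s => v s x i) t := by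
    intro x
    refine (aux_time _ cF3 t x).unique ?_
    have := (HasDerivAt.fun_sum (u := Finset.univ) fun (i : Fin 3) _ => (vt x i).pow 2).div_const 2
    refine HasDerivAt.congr_deriv (f := fun s => (∑ i : Fin 3, (v s x i) ^ 2) / 2) this ?_
    simp only [Fin.sum_univ_three]
    norm_num
    ring
  -- the surface energy
  have pζ : ∀ j s x, pd j (ζ s) x =
      fderiv ℝ (fun p : ℝ × E2 => ζ p.1 p.2) (s, x) (0, EuclideanSpace.single j 1) :=
    fun j s x => aux_slice _ hζ s x _
  have cpζ : ∀ j, ContDiff ℝ (⊤ : ℕ∞) (fun p : ℝ × E2 => pd j (ζ p.1) p.2) := by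
    intro j
    simp only [pζ]
    exact aux_cd_dir _ hζ _
  have hZteq : (fun x => deriv (fun s => ζ s x) t) =
      fun x => fderiv ℝ (fun p : ℝ × E2 => ζ p.1 p.2) (t, x) (1, 0) := by
    funext x
    exact (aux_time _ hζ t x).deriv
  have cζt := aux_cd_dir _ hζ ((1 : ℝ), (0 : E2))
  have hZt : ContDiff ℝ (⊤ : ℕ∞) (fun x => deriv (fun s => ζ s x) t) := by
    rw [hZteq]
    exact cζt.comp s2
  have pζt : ∀ j x, HasDerivAt (fun s => pd j (ζ s) x)
      (pd j (fun x => deriv (fun s => ζ s x) t) x) t := by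
    intro j x
    have h1 := aux_time _ (cpζ j) t x
    convert h1 using 1
    simp only [pζ]
    rw [aux_dir_comm _ hζ, hZteq]
    exact aux_slice _ cζt t x _
  have cF2 : ContDiff ℝ (⊤ : ℕ∞) (fun p : ℝ × E2 => (ζ p.1 p.2) ^ 2 / 2
                + σ₀ * ((pd 0 (ζ p.1) p.2) ^ 2 + (pd 1 (ζ p.1) p.2) ^ 2) / 2
                + (-σ₀' / (2 * c₀)) * (h p.1 p.2) ^ 2) :=
    (((hζ.pow 2).div_const 2).add
      ((contDiff_const.mul (((cpζ 0).pow 2).add ((cpζ 1).pow 2))).div_const 2)).add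
      (contDiff_const.mul (hh.pow 2))
  have D2 := aux_param (volume : Measure E2) _ (aux_compact_Q2 L₁ L₂) _ (cF2.of_le (by simp)) t
  have e2 : ∀ x : E2, fderiv ℝ (fun p : ℝ × E2 => (ζ p.1 p.2) ^ 2 / 2
                + σ₀ * ((pd 0 (ζ p.1) p.2) ^ 2 + (pd 1 (ζ p.1) p.2) ^ 2) / 2
                + (-σ₀' / (2 * c₀)) * (h p.1 p.2) ^ 2) (t, x) (1, 0)
      = ζ t x * deriv (fun s => ζ s x) t
        + σ₀ * (pd 0 (ζ t) x * pd 0 (fun x => deriv (fun s => ζ s x) t) x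
          + pd 1 (ζ t) x * pd 1 (fun x => deriv (fun s => ζ s x) t) x)
        + (-σ₀' / c₀) * (h t x * deriv (fun s => h s x) t) := by
    intro x
    refine (aux_time _ cF2 t x).unique ?_
    have := ((((ζt x).pow 2).div_const 2).add
      (((((pζt 0 x).pow 2).add ((pζt 1 x).pow 2)).const_mul σ₀).div_const 2)).add
      (((ht x).pow 2).const_mul (-σ₀' / (2 * c₀)))
    refine HasDerivAt.congr_deriv (f := fun s => (ζ s x) ^ 2 / 2
                + σ₀ * ((pd 0 (ζ s) x) ^ 2 + (pd 1 (ζ s) x) ^ 2) / 2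
                + (-σ₀' / (2 * c₀)) * (h s x) ^ 2) this ?_
    norm_num
    field_simp
  simp only [e3] at D3
  simp only [e2] at D2
  have P3 := aux_part3 L₁ L₂ b hL₁ hL₂ hb (fun i x => v t x i)
    (fun i x => deriv (fun s => v s x i) t) (fun i x => Φ1 t x i) (q t) (Φ2 t) hV hQ
    (fun i => ((hΦ1i i).comp s3).continuous) (hvp t) (hqp t) (heq1 t) (heq2 t) (heq6 t)
  have P2 := aux_part2 L₁ L₂ σ₀ σ₀' c₀ γ hL₁ hL₂ hc₀ (ζ t) (fun x => deriv (fun s => ζ s x) t)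
    (h t) (fun x => deriv (fun s => h s x) t) (Φ4 t) (Φ5 t)
    (fun x => auxG (fun i x => v t x i) (q t) 2 (emb 0 x)) (fun i x => v t (emb 0 x) i)
    (fun i x => Φ3 t x i) hZ hZt hH (fun i => (hV i).comp (aux_emb_contDiff 0))
    (fun i => ((hΦ3i i).comp s2).continuous) (hΦ4.comp s2).continuous (hΦ5.comp s2).continuous
    ((auxG_contDiff (V := fun i x => v t x i) hV hQ 2).comp (aux_emb_contDiff 0)).continuous
    (hζp t)
    ⟨fun x => by simp only [(hζp _).1], fun x => by simp only [(hζp _).2]⟩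
    (hhp t) (fun i => aux_per_emb 0 (hvp t i))
    (by
      intro x
      simp only [auxG, Fin.sum_univ_three, ← heq3]
      simp
      ring)
    (heq4 t)
    (by
      intro x
      rw [(aux_pd_emb 0 (hV 0) x).1, (aux_pd_emb 0 (hV 1) x).2]
      exact heq5 t x)
  refine (D3.add D2).congr_deriv ?_
  rw [P3, P2]
  ring
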